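/- arXiv:1701.05617 — 11 statements merged into one kernel-verified Lean document; each statement's English description precedes it below -/
import Mathlib

section
/- Let f : ∀ (X : Type), X → X be a function that is natural under equivalence. If it is not the case that f Bool x = x for all x : Bool, then the law of excluded middle holds. -/
/-- A subsingleton with a point becomes equivalent to `Bool` after adding one more point,
the added point corresponding to `false`. -/
def optionEquivBoolOfSubsingleton {P : Type} (hP : Subsingleton P) (p : P) : Option P ≃ Bool where
  toFun := Option.isSome
  invFun
    | true => some p
    | false => none
  left_inv
    | none => rfl
    | some q => congrArg some (hP.elim p q)
  right_inv
    | true => rfl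
    | false => rfl

/-- A self-map of `Bool` that commutes with negation and fixes `false` is the identity. -/
theorem eq_self_of_not_comm_of_false {g : Bool → Bool} (hg : ∀ x, (!g x) = g (!x))
    (h : g false = false) : ∀ x, g x = x
  | false => h
  | true => (hg false).symm.trans (congrArg not h)

/-- If `f : ∀ X : Type, X → X` is natural under equivalence and `f Bool` is not
pointwise equal to the identity, then the law of excluded middle holds. -/
theorem stmt_0 (f : ∀ X : Type, X → X)
    (hnat : ∀ (X Y : Type) (e : X ≃ Y) (x : X), e (f X x) = f Y (e x))
    (hne : ¬ ∀ x : Bool, f Bool x = x) :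
    ∀ P : Type, Subsingleton P → Nonempty P ∨ IsEmpty P := by
  intro P hP
  match h : f (Option P) none with
  | some p => exact Or.inl ⟨p⟩
  | none =>
    refine Or.inr ⟨fun p => hne (eq_self_of_not_comm_of_false ?_ ?_)⟩
    · exact hnat Bool Bool ⟨not, not, Bool.not_not, Bool.not_not⟩
    · exact (hnat _ _ (optionEquivBoolOfSubsingleton hP p) none).symm.trans
        (congrArg Option.isSome h)
end

section
/- There exists a function f : ∀ (X : Type), X → X that is natural under equivalence and such that it is not the case that f Bool x = x for all x : Bool. -/
open Classical in
/-- The unique point of `X` different from `x` if there is one, and `x` itself otherwise. -/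
noncomputable def uniqueOther (X : Type) (x : X) : X :=
  if h : ∃! y, y ≠ x then h.choose else x

theorem uniqueOther_eq {X : Type} {x y : X} (hy : y ≠ x) (h : ∀ z, z ≠ x → z = y) :
    uniqueOther X x = y := by
  have hex : ∃! y, y ≠ x := ⟨y, hy, h⟩
  rw [uniqueOther, dif_pos hex]
  exact h _ hex.choose_spec.1

theorem uniqueOther_of_not {X : Type} {x : X} (h : ¬ ∃! y, y ≠ x) : uniqueOther X x = x :=
  dif_neg h

theorem Equiv.existsUnique_ne_apply_iff {X Y : Type} (e : X ≃ Y) (x : X) :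
    (∃! y, y ≠ e x) ↔ ∃! y, y ≠ x :=
  (e.existsUnique_congr fun {y} => (e.injective.ne_iff (x := y) (y := x)).symm).symm

theorem Equiv.apply_uniqueOther {X Y : Type} (e : X ≃ Y) (x : X) :
    e (uniqueOther X x) = uniqueOther Y (e x) := by
  by_cases h : ∃! y, y ≠ x
  · obtain ⟨y, hy, hu⟩ := h
    rw [uniqueOther_eq hy hu, uniqueOther_eq (e.injective.ne hy)]
    intro z hz
    rw [← e.symm_apply_eq]
    exact hu _ fun hzx => hz (e.symm_apply_eq.mp hzx)
  · rw [uniqueOther_of_not h, uniqueOther_of_not (mt (e.existsUnique_ne_apply_iff x).mp h)]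

/-- There exists a function `f : ∀ X : Type, X → X` that is natural under
equivalence and such that `f Bool` is not pointwise equal to the identity. -/
theorem stmt_1 :
    ∃ f : ∀ X : Type, X → X,
      (∀ (X Y : Type) (e : X ≃ Y) (x : X), e (f X x) = f Y (e x)) ∧
      ¬ ∀ x : Bool, f Bool x = x := by
  refine ⟨uniqueOther, fun X Y e x => e.apply_uniqueOther x, fun h => ?_⟩
  have hf : uniqueOther Bool true = false := uniqueOther_eq (by decide) (by decide)
  exact Bool.false_ne_true (hf.symm.trans (h true))
end

section
/- For a type X and a point x : X, the following are equivalent: (1) x is isolated, i.e. equality with x is decidable (there is a function assigning to every y : X a decision of x = y); (2) there exist a type Y and an equivalence e : X ≃ (Y ⊕ Unit) such that e x = Sum.inr (). -/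
/-- A point with decidable equality splits off as a summand `Unit`. -/
def equivNeSumUnit {X : Type*} (x : X) [∀ y : X, Decidable (x = y)] :
    X ≃ {y : X // ¬x = y} ⊕ Unit where
  toFun y := if h : x = y then Sum.inr () else Sum.inl ⟨y, h⟩
  invFun := Sum.elim Subtype.val fun _ => x
  left_inv y := by
    by_cases h : x = y <;> simp [h]
  right_inv := by
    rintro (⟨y, h⟩ | _) <;> simp [*]

theorem equivNeSumUnit_self {X : Type*} (x : X) [∀ y : X, Decidable (x = y)] :
    equivNeSumUnit x x = Sum.inr () :=
  dif_pos rfl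

/-- Equality with a point that is split off as a summand `Unit` is decidable. -/
def decidableEqOfEquivSumUnit {X Y : Type*} {x : X} (e : X ≃ Y ⊕ Unit)
    (he : e x = Sum.inr ()) (y : X) : Decidable (x = y) :=
  match h : e y with
  | Sum.inl _ => isFalse fun hxy => by simp [← hxy, he] at h
  | Sum.inr _ => isTrue (e.injective (he.trans h.symm))

/-- A point `x : X` is isolated (equality with `x` is decidable) if and only if
`X` is equivalent to `Y ⊕ Unit` for some `Y`, by an equivalence sending `x` to
`Sum.inr ()`. -/
theorem stmt_2 (X : Type) (x : X) :
    Nonempty (∀ y : X, Decidable (x = y)) ↔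
      ∃ (Y : Type) (e : X ≃ Y ⊕ Unit), e x = Sum.inr () := by
  constructor
  · rintro ⟨_⟩
    exact ⟨_, equivNeSumUnit x, equivNeSumUnit_self x⟩
  · rintro ⟨_, e, he⟩
    exact ⟨decidableEqOfEquivSumUnit e he⟩
end

section
/- Let f : ∀ (X : Type), X → X be natural under equivalence, and suppose there is a type X with an isolated point x : X such that f X x ≠ x. Then the law of excluded middle holds. -/
/-- If `x` is isolated and `P` is a subsingleton inhabited by `p`, then `X` is the disjoint union
of `{y // y ≠ x} × P` and a point corresponding to `x`. -/
def optionNeProdEquiv {X P : Type} [Subsingleton P] (x : X) (hiso : ∀ y : X, Decidable (x = y))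
    (p : P) : Option ({y : X // y ≠ x} × P) ≃ X where
  toFun
    | none => x
    | some z => z.1
  invFun y := match hiso y with
    | isTrue _ => none
    | isFalse h => some (⟨y, Ne.symm h⟩, p)
  left_inv z := by
    match z with
    | none =>
      dsimp only
      cases hiso x with
      | isTrue _ => rfl
      | isFalse h => exact absurd rfl h
    | some (⟨y, hy⟩, q) =>
      dsimp only
      cases hiso y with
      | isTrue h => exact absurd h.symm hy
      | isFalse _ => rw [Subsingleton.elim q p]
  right_inv y := by
    dsimp only
    cases hiso y with
    | isTrue h => exact h
    | isFalse _ => rfl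

/-- If `f : ∀ X : Type, X → X` is natural under equivalence and there is a type
`X` with an isolated point `x` such that `f X x ≠ x`, then the law of excluded
middle holds. -/
theorem stmt_3 (f : ∀ X : Type, X → X)
    (hnat : ∀ (X Y : Type) (e : X ≃ Y) (x : X), e (f X x) = f Y (e x))
    (X : Type) (x : X) (hiso : ∀ y : X, Decidable (x = y))
    (hne : f X x ≠ x) :
    ∀ P : Type, Subsingleton P → Nonempty P ∨ IsEmpty P := by
  intro P _
  match h : f (Option ({y : X // y ≠ x} × P)) none with
  | some z => exact Or.inl ⟨z.2⟩
  | none =>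
    refine Or.inr ⟨fun p => hne ?_⟩
    have key := hnat _ _ (optionNeProdEquiv x hiso p) none
    rw [h] at key
    exact key.symm
end

section
/- The following are equivalent: (1) there exist a function f : ∀ (X : Type), X → X natural under equivalence, a type X, and a point x : X with f X x ≠ x; (2) the law of excluded middle holds. -/
/-- `y` is the image of `x` under the transposition of a two-element type. -/
def IsOtherPoint {X : Type} (x y : X) : Prop :=
  y ≠ x ∧ ∀ z, z = x ∨ z = y

theorem IsOtherPoint.unique {X : Type} {x y y' : X} (h : IsOtherPoint x y)
    (h' : IsOtherPoint x y') : y = y' :=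
  (h'.2 y).resolve_left h.1

theorem IsOtherPoint.map {X Y : Type} {x y : X} (h : IsOtherPoint x y) (e : X ≃ Y) :
    IsOtherPoint (e x) (e y) :=
  ⟨fun he => h.1 (e.injective he), fun z =>
    (h.2 (e.symm z)).imp e.symm_apply_eq.1 e.symm_apply_eq.1⟩

/-- Given a proposition `P`, apply `f` to the subtype of `X` which is all of `X` if `P` holds and
the singleton of `x` otherwise. Excluded middle itself is not used in the proof. -/
theorem em_of_natural_of_ne (f : ∀ X : Type, X → X)
    (hf : ∀ (X Y : Type) (e : X ≃ Y) (x : X), e (f X x) = f Y (e x))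
    {X : Type} {x : X} (hx : f X x ≠ x) (P : Prop) : P ∨ ¬P := by
  let y : {y : X // P ∨ y = x} := f _ ⟨x, Or.inr rfl⟩
  refine y.2.imp_right fun hy hP => hx ?_
  let e : {y : X // P ∨ y = x} ≃ X :=
    ⟨Subtype.val, fun z => ⟨z, Or.inl hP⟩, fun _ => rfl, fun _ => rfl⟩
  exact (hf _ _ e ⟨x, Or.inr rfl⟩).symm.trans hy

/-- From excluded middle, the map that swaps the points of two-element types and is the identity
on all other types. -/
theorem exists_natural_ne_of_em (em : ∀ P : Prop, P ∨ ¬P) :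
    ∃ f : ∀ X : Type, X → X,
      (∀ (X Y : Type) (e : X ≃ Y) (x : X), e (f X x) = f Y (e x)) ∧
      ∃ (X : Type) (x : X), f X x ≠ x := by
  have hex (X : Type) (x : X) :
      ∃ y, IsOtherPoint x y ∨ (¬∃ z, IsOtherPoint x z) ∧ y = x := by
    rcases em (∃ z, IsOtherPoint x z) with ⟨y, hy⟩ | h
    · exact ⟨y, Or.inl hy⟩
    · exact ⟨x, Or.inr ⟨h, rfl⟩⟩
  choose f hf using hex
  refine ⟨f, fun X Y e x => ?_, Bool, true, ?_⟩
  · rcases hf X x with h | ⟨h, hx⟩ <;> rcases hf Y (e x) with h' | ⟨h', hx'⟩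
    · exact (h.map e).unique h'
    · exact absurd ⟨_, h.map e⟩ h'
    · exact absurd ⟨_, by simpa using h'.map e.symm⟩ h
    · rw [hx, hx']
  · have hBool : IsOtherPoint true false := ⟨by decide, by decide⟩
    rcases hf Bool true with h | ⟨h, -⟩
    · exact h.1
    · exact absurd ⟨_, hBool⟩ h

/-- There exist an equivalence-natural `f : ∀ X : Type, X → X`, a type `X` and
a point `x : X` with `f X x ≠ x`, if and only if the law of excluded middle
holds. -/
theorem stmt_4 :
    (∃ f : ∀ X : Type, X → X,
      (∀ (X Y : Type) (e : X ≃ Y) (x : X), e (f X x) = f Y (e x)) ∧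
      ∃ (X : Type) (x : X), f X x ≠ x) ↔
    (∀ P : Type, Subsingleton P → Nonempty P ∨ IsEmpty P) := by
  constructor
  · rintro ⟨f, hf, X, x, hx⟩ P -
    exact (em_of_natural_of_ne f hf hx (Nonempty P)).imp_right fun h => ⟨fun p => h ⟨p⟩⟩
  · intro lem
    refine exists_natural_ne_of_em fun P => ?_
    exact (lem (PLift P) inferInstance).imp (fun ⟨⟨hP⟩⟩ => hP) fun h hP => h.false ⟨hP⟩
end

section
/- There exists a function f : Type → Bool that is extensional (equivalent types get equal values) and strongly non-constant (there are types X, Y with f X ≠ f Y) if and only if weak excluded middle holds. -/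
/-- A type that is equivalent to `X` when `p` is false and to `Y` when `¬ p` is false. -/
def WeakChoice (p : Prop) (X Y : Type) : Type := (¬ p → X) × (¬ ¬ p → Y)

namespace WeakChoice

variable {p : Prop} {X Y : Type}

def equivLeft (h : ¬ p) : WeakChoice p X Y ≃ X where
  toFun z := z.1 h
  invFun x := (fun _ => x, fun hn => (hn h).elim)
  left_inv _ := Prod.ext rfl (funext fun hn => (hn h).elim)
  right_inv _ := rfl

def equivRight (h : ¬ ¬ p) : WeakChoice p X Y ≃ Y where
  toFun z := z.2 h
  invFun y := (fun hn => (h hn).elim, fun _ => y)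
  left_inv _ := Prod.ext (funext fun hn => (h hn).elim) rfl
  right_inv _ := rfl

end WeakChoice

/-- Rice's theorem for types. The proof does not use the axiom of choice. -/
theorem not_or_not_not_of_extensional {f : Type → Bool}
    (hf : ∀ X Y : Type, Nonempty (X ≃ Y) → f X = f Y) {X Y : Type} (hXY : f X ≠ f Y)
    (p : Prop) : ¬ p ∨ ¬ ¬ p :=
  match decEq (f (WeakChoice p X Y)) (f X) with
  | isTrue h => Or.inl fun hp =>
      hXY (h.symm.trans (hf _ _ ⟨WeakChoice.equivRight fun hn => hn hp⟩))
  | isFalse h => Or.inr fun hn => h (hf _ _ ⟨WeakChoice.equivLeft hn⟩)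

/-- Weak excluded middle makes emptiness a Boolean invariant of types. Choice is used only to
extract a decision from each disjunction. -/
theorem exists_extensional_of_isEmpty_or_not (h : ∀ A : Type, IsEmpty A ∨ ¬ IsEmpty A) :
    ∃ f : Type → Bool,
      (∀ X Y : Type, Nonempty (X ≃ Y) → f X = f Y) ∧ ∃ X Y : Type, f X ≠ f Y := by
  have hdec (A : Type) : ∃ b : Bool, b = true ↔ IsEmpty A :=
    (h A).elim (fun hA => ⟨true, fun _ => hA, fun _ => rfl⟩)
      (fun hA => ⟨false, fun hb => Bool.noConfusion hb, fun hA' => (hA hA').elim⟩)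
  choose f hf using hdec
  refine ⟨f, fun X Y ⟨e⟩ => Bool.eq_iff_iff.2 ?_, Empty, Unit, fun heq => ?_⟩
  · exact (hf X).trans (e.isEmpty_congr.trans (hf Y).symm)
  · exact ((hf Unit).1 (heq ▸ (hf Empty).2 ⟨Empty.elim⟩)).false ()

/-- There is an extensional, strongly non-constant function `f : Type → Bool`
if and only if weak excluded middle holds. -/
theorem stmt_5 :
    (∃ f : Type → Bool,
      (∀ X Y : Type, Nonempty (X ≃ Y) → f X = f Y) ∧
      ∃ X Y : Type, f X ≠ f Y) ↔
    (∀ A : Type, IsEmpty A ∨ ¬ IsEmpty A) := by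
  refine ⟨?_, exists_extensional_of_isEmpty_or_not⟩
  rintro ⟨f, hf, X, Y, hXY⟩ A
  have hA : IsEmpty A ↔ ¬ Nonempty A :=
    ⟨fun hA ⟨a⟩ => hA.false a, fun hA => ⟨fun a => hA ⟨a⟩⟩⟩
  rw [hA]
  exact not_or_not_not_of_extensional hf hXY (Nonempty A)
end

section
/- Weak excluded middle holds if and only if there exist a function f : ∀ (X : Type), X → Bool invariant under equivalence, together with types X, Y with isolated points x : X and y : Y, such that f X x ≠ f Y y. -/
/-- If `x` is isolated, `P` holds and `W` is empty, then `X` is recovered by adjoining a point to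
the sum of the complement of `x`, cut down by `P`, and `W`. -/
def optionSumComplEquiv {X W : Type} (x : X) (dec : ∀ x' : X, Decidable (x = x'))
    {P : Prop} (hP : P) (hW : W → False) :
    Option ({x' : X // x ≠ x' ∧ P} ⊕ W) ≃ X where
  toFun
    | none => x
    | some (Sum.inl x') => x'.1
    | some (Sum.inr w) => (hW w).elim
  invFun x' := match dec x' with
    | isTrue _ => none
    | isFalse h => some (Sum.inl ⟨x', h, hP⟩)
  left_inv
    | none => by
      cases h : dec x with
      | isTrue _ => simp only [h]
      | isFalse hne => exact (hne rfl).elim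
    | some (Sum.inl x') => by
      cases h : dec x'.1 with
      | isTrue heq => exact (x'.2.1 heq).elim
      | isFalse _ => simp only [h]
    | some (Sum.inr w) => (hW w).elim
  right_inv x' := by
    cases h : dec x' with
    | isTrue heq => simp only [h, heq]
    | isFalse _ => simp only [h]

/-- An equivalence-invariant function separating two isolated points decides emptiness up to
double negation. -/
theorem isEmpty_or_not_isEmpty_of_separates (f : ∀ X : Type, X → Bool)
    (hf : ∀ (X Y : Type) (e : X ≃ Y) (x : X), f Y (e x) = f X x)
    {X Y : Type} (x : X) (y : Y) (dx : ∀ x' : X, Decidable (x = x'))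
    (dy : ∀ y' : Y, Decidable (y = y')) (hne : f X x ≠ f Y y) (A : Type) :
    IsEmpty A ∨ ¬ IsEmpty A := by
  let U := {x' : X // x ≠ x' ∧ IsEmpty A}
  let V := {y' : Y // y ≠ y' ∧ ¬ IsEmpty A}
  have hX (hA : IsEmpty A) : f X x = f (Option (U ⊕ V)) none :=
    hf _ _ (optionSumComplEquiv x dx hA fun v : V => v.2.2 hA) none
  have hY (hA : ¬ IsEmpty A) : f Y y = f (Option (U ⊕ V)) none :=
    (hf _ _ (optionSumComplEquiv y dy hA fun u : U => hA u.2.2) none).trans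
      (hf _ _ (Equiv.optionCongr (Equiv.sumComm U V)) none)
  cases decEq (f X x) (f (Option (U ⊕ V)) none) with
  | isTrue h => exact Or.inl ⟨fun a => hne (h.trans (hY fun hA => hA.false a).symm)⟩
  | isFalse h => exact Or.inr fun hA => h (hX hA)

/-- Weak excluded middle yields an equivalence-invariant function separating the point of `Unit`
from a point of `Bool`, namely the one deciding whether the complement of a point is empty. -/
theorem exists_invariant_separating (h : ∀ A : Type, IsEmpty A ∨ ¬ IsEmpty A) :
    ∃ f : ∀ X : Type, X → Bool,
      (∀ (X Y : Type) (e : X ≃ Y) (x : X), f Y (e x) = f X x) ∧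
      f Unit () ≠ f Bool true := by
  have dec (A : Type) : Nonempty (Decidable (IsEmpty A)) :=
    (h A).elim (fun hA => ⟨isTrue hA⟩) (fun hA => ⟨isFalse hA⟩)
  let d (A : Type) : Decidable (IsEmpty A) := Classical.choice (dec A)
  refine ⟨fun X x => @decide (IsEmpty {x' : X // x' ≠ x}) (d _), fun X Y e x => ?_, ?_⟩
  · have e' : {x' : X // x' ≠ x} ≃ {y' : Y // y' ≠ e x} :=
      e.subtypeEquiv fun a => not_congr e.apply_eq_iff_eq.symm
    exact decide_eq_decide.2 e'.symm.isEmpty_congr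
  · have hU : IsEmpty {x' : Unit // x' ≠ ()} := ⟨fun u => u.2 rfl⟩
    have hB : ¬ IsEmpty {b : Bool // b ≠ true} := fun hB => hB.false ⟨false, Bool.false_ne_true⟩
    exact fun heq => hB ((decide_eq_decide.1 heq).1 hU)

/-- Weak excluded middle holds if and only if there is an equivalence-invariant
`f : ∀ X : Type, X → Bool` together with types `X`, `Y` with isolated points
`x : X`, `y : Y` such that `f X x ≠ f Y y`. -/
theorem stmt_6 :
    (∀ A : Type, IsEmpty A ∨ ¬ IsEmpty A) ↔
    (∃ f : ∀ X : Type, X → Bool,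
      (∀ (X Y : Type) (e : X ≃ Y) (x : X), f Y (e x) = f X x) ∧
      ∃ (X Y : Type) (x : X) (y : Y),
        Nonempty (∀ x' : X, Decidable (x = x')) ∧
        Nonempty (∀ y' : Y, Decidable (y = y')) ∧
        f X x ≠ f Y y) := by
  constructor
  · intro h
    obtain ⟨f, hf, hne⟩ := exists_invariant_separating h
    exact ⟨f, hf, Unit, Bool, (), true, ⟨fun _ => inferInstance⟩, ⟨fun _ => inferInstance⟩, hne⟩
  · rintro ⟨f, hf, X, Y, x, y, ⟨dx⟩, ⟨dy⟩, hne⟩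
    exact isEmpty_or_not_isEmpty_of_separates f hf x y dx dy hne
end

section
/- Weak excluded middle holds if and only if there exist a function f : ∀ (X : Type), X → Bool invariant under equivalence, together with types X, Y and points x : X, y : Y, such that f X x ≠ f Y y. -/
/-- If `P` holds and `Q` is refutable, then `(P → X) × (Q → Y)` is just `X`. -/
def Equiv.prodArrowOfPosNeg {P Q : Prop} (X Y : Type) (hP : P) (hQ : ¬ Q) :
    (P → X) × (Q → Y) ≃ X where
  toFun z := z.1 hP
  invFun x := (fun _ => x, fun q => (hQ q).elim)
  left_inv _ := Prod.ext rfl (funext fun q => (hQ q).elim)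
  right_inv _ := rfl

/-- An invariant Boolean function on pointed types that separates two pointed types decides
whether any given type is empty. -/
theorem isEmpty_or_not_isEmpty_of_invariant {f : ∀ X : Type, X → Bool}
    (hf : ∀ (X Y : Type) (e : X ≃ Y) (x : X), f Y (e x) = f X x)
    {X Y : Type} {x : X} {y : Y} (hxy : f X x ≠ f Y y) (A : Type) :
    IsEmpty A ∨ ¬ IsEmpty A := by
  let z : (¬ ¬ IsEmpty A → X) × (¬ IsEmpty A → Y) := (fun _ => x, fun _ => y)
  have hX (h : ¬ ¬ IsEmpty A) : f X x = f _ z :=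
    hf _ _ (Equiv.prodArrowOfPosNeg X Y h h) z
  have hY (h : ¬ IsEmpty A) : f Y y = f _ z :=
    hf _ _ ((Equiv.prodComm _ _).trans (Equiv.prodArrowOfPosNeg Y X h (not_not_intro h))) z
  match decEq (f X x) (f _ z) with
  | isTrue h => exact .inl ⟨fun a => (fun hA : ¬ IsEmpty A => hxy (h.trans (hY hA).symm))
      fun hA => hA.false a⟩
  | isFalse h => exact .inr fun hA => h (hX (not_not_intro hA))

/-- Weak excluded middle yields an invariant Boolean function on pointed types recognising the
types whose only point is the base point. -/
theorem exists_invariant_of_isEmpty_or_not_isEmpty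
    (wem : ∀ A : Type, IsEmpty A ∨ ¬ IsEmpty A) :
    ∃ f : ∀ X : Type, X → Bool,
      (∀ (X Y : Type) (e : X ≃ Y) (x : X), f Y (e x) = f X x) ∧
      ∀ (X : Type) (x : X), f X x = true ↔ IsEmpty {x' : X // x' ≠ x} := by
  have dec (A : Type) : ∃ b : Bool, b = true ↔ IsEmpty A :=
    (wem A).elim (fun h => ⟨true, by simp [h]⟩) (fun h => ⟨false, by simpa using h⟩)
  choose g hg using dec
  refine ⟨fun X x => g {x' : X // x' ≠ x}, fun X Y e x => ?_, fun X x => hg _⟩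
  rw [Bool.eq_iff_iff, hg, hg]
  have hne (a : X) : a ≠ x ↔ e a ≠ e x := e.injective.ne_iff.symm
  exact (e.subtypeEquiv hne).isEmpty_congr.symm

/-- Weak excluded middle holds if and only if there is an equivalence-invariant
`f : ∀ X : Type, X → Bool` together with types `X`, `Y` and points `x : X`,
`y : Y` such that `f X x ≠ f Y y`. -/
theorem stmt_7 :
    (∀ A : Type, IsEmpty A ∨ ¬ IsEmpty A) ↔
    (∃ f : ∀ X : Type, X → Bool,
      (∀ (X Y : Type) (e : X ≃ Y) (x : X), f Y (e x) = f X x) ∧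
      ∃ (X Y : Type) (x : X) (y : Y), f X x ≠ f Y y) := by
  constructor
  · intro wem
    obtain ⟨f, hf, hf'⟩ := exists_invariant_of_isEmpty_or_not_isEmpty wem
    refine ⟨f, hf, Unit, Bool, (), true, fun h => ?_⟩
    have hUnit : f Unit () = true := (hf' _ _).2 ⟨fun a => a.2 rfl⟩
    exact ((hf' _ _).1 (h ▸ hUnit)).false ⟨false, Bool.false_ne_true⟩
  · rintro ⟨f, hf, X, Y, x, y, hxy⟩
    exact isEmpty_or_not_isEmpty_of_invariant hf hxy
end

section
/- Suppose P, Q : ∀ (X : Type), X → Type are invariant under pointed equivalence, that for every type Z and point z : Z either P Z z is inhabited or Q Z z is inhabited, and that there are types X, Y with points x : X, y : Y such that P X x is empty and Q Y y is empty. Then weak excluded middle holds. -/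
/-- For incompatible propositions `p` and `q`, if `p` holds then `(p → X) × (q → Y)` is equivalent
to `X` by evaluation. -/
def prodArrowEquivLeft {p q : Prop} (hp : p) (hq : ¬ q) (X Y : Type) :
    ((p → X) × (q → Y)) ≃ X where
  toFun f := f.1 hp
  invFun a := (fun _ => a, fun h => (hq h).elim)
  left_inv _ := Prod.ext rfl (funext fun h => (hq h).elim)
  right_inv _ := rfl

/-- For incompatible propositions `p` and `q`, if `q` holds then `(p → X) × (q → Y)` is equivalent
to `Y` by evaluation. -/
def prodArrowEquivRight {p q : Prop} (hp : ¬ p) (hq : q) (X Y : Type) :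
    ((p → X) × (q → Y)) ≃ Y where
  toFun f := f.2 hq
  invFun b := (fun h => (hp h).elim, fun _ => b)
  left_inv _ := Prod.ext (funext fun h => (hp h).elim) rfl
  right_inv _ := rfl

/-- If `P Q : ∀ X : Type, X → Type` are invariant under pointed equivalence,
every pointed type lies in `P` or in `Q` (inhabitedness), and there are pointed
types `(X, x)`, `(Y, y)` with `P X x` empty and `Q Y y` empty, then weak
excluded middle holds. -/
theorem stmt_9 (P Q : ∀ X : Type, X → Type)
    (hP : ∀ (X Y : Type) (e : X ≃ Y) (x : X) (y : Y),
      e x = y → Nonempty (P X x ≃ P Y y))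
    (hQ : ∀ (X Y : Type) (e : X ≃ Y) (x : X) (y : Y),
      e x = y → Nonempty (Q X x ≃ Q Y y))
    (hcover : ∀ (Z : Type) (z : Z), Nonempty (P Z z) ∨ Nonempty (Q Z z))
    (X Y : Type) (x : X) (y : Y)
    (hX : IsEmpty (P X x)) (hY : IsEmpty (Q Y y)) :
    ∀ A : Type, IsEmpty A ∨ ¬ IsEmpty A := by
  intro A
  rcases hcover ((IsEmpty A → X) × (¬ IsEmpty A → Y)) (fun _ => x, fun _ => y) with hu | hu
  · refine Or.inr fun h => ?_
    obtain ⟨e⟩ := hP _ X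
      (prodArrowEquivLeft h (not_not_intro h) X Y) (fun _ => x, fun _ => y) x rfl
    exact hu.elim fun u => hX.false (e u)
  · refine Or.inl ⟨fun a => ?_⟩
    have h : ¬ IsEmpty A := fun k => k.false a
    obtain ⟨e⟩ := hQ _ Y
      (prodArrowEquivRight h h X Y) (fun _ => x, fun _ => y) y rfl
    exact hu.elim fun u => hY.false (e u)
end

section
/- Assume propositional extensionality for types: any two logically equivalent subsingleton types are equal. If there is an injective (left-cancellable) function f : Type → Type with f PUnit = PEmpty, then the law of double-negation elimination holds. -/
/-- Assuming propositional extensionality for types, if there is an injective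
map `f : Type → Type` with `f PUnit = PEmpty`, then double-negation elimination
holds. -/
theorem stmt_14
    (propext' : ∀ P Q : Type, Subsingleton P → Subsingleton Q →
      (P → Q) → (Q → P) → P = Q)
    (f : Type → Type) (hinj : ∀ X Y : Type, f X = f Y → X = Y)
    (hf : f PUnit = PEmpty) :
    ∀ P : Type, Subsingleton P → ¬¬ Nonempty P → Nonempty P := by
  intro P hP hnn
  have inhabited_eq (p : P) : P = PUnit :=
    propext' P PUnit hP inferInstance (fun _ => ⟨⟩) (fun _ => p)
  have fP_empty : f P → False := fun x => hnn fun ⟨p⟩ =>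
    (cast ((congrArg f (inhabited_eq p)).trans hf) x).elim
  have fP_eq : f P = PEmpty :=
    propext' (f P) PEmpty ⟨fun x _ => (fP_empty x).elim⟩ inferInstance
      (fun x => (fP_empty x).elim) PEmpty.elim
  have hP_eq : P = PUnit := hinj P PUnit (fP_eq.trans hf.symm)
  exact ⟨cast hP_eq.symm ⟨⟩⟩
end

section
/- Assume propositional extensionality for types: any two logically equivalent subsingleton types are equal. If there is an equivalence (automorphism) f : Type ≃ Type with f PUnit = PEmpty, then the law of double-negation elimination holds. -/
/-- Assuming propositional extensionality for types, if there is an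
automorphism `f : Type ≃ Type` with `f PUnit = PEmpty`, then double-negation
elimination holds. -/
theorem stmt_15
    (propext' : ∀ P Q : Type, Subsingleton P → Subsingleton Q →
      (P → Q) → (Q → P) → P = Q)
    (f : Type ≃ Type) (hf : f PUnit = PEmpty) :
    ∀ P : Type, Subsingleton P → ¬¬ Nonempty P → Nonempty P := by
  intro P hP hnn
  have not_image : f P → False := fun y => hnn fun ⟨p⟩ => by
    have hPU : P = PUnit :=
      propext' P PUnit hP ⟨fun _ _ => rfl⟩ (fun _ => PUnit.unit) (fun _ => p)
    have hfP : f P = PEmpty := (congrArg f hPU).trans hf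
    exact (cast hfP y).elim
  have hfP : f P = PEmpty :=
    propext' (f P) PEmpty ⟨fun a _ => (not_image a).elim⟩ ⟨fun a _ => a.elim⟩
      (fun y => (not_image y).elim) (fun e => e.elim)
  have hPU : P = PUnit := f.injective (hfP.trans hf.symm)
  exact ⟨cast hPU.symm PUnit.unit⟩
end
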